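/- Let H be a hypergraph satisfying Condition (A) and K a field. Then L_K(H) is infinite-dimensional as a K-vector space, L_K(H) has infinitely many two-sided ideals (in particular it is not simple), L_K(H) is neither left nor right Artinian, and L_K(H) is not von Neumann regular. -/

import Mathlib

open scoped Classical

/-- The generators of the Leavitt path algebra of a hypergraph `H = (H0, H1, s, r)`:
a vertex generator `v` for every `v ∈ H0`, and generators `h_{ij}` (`edge`) and
`h_{ij}^*` (`ghost`) for every hyperedge `h ∈ H1`, `1 ≤ i ≤ |s(h)|`, `1 ≤ j ≤ |r(h)|`.
The multisets `s(h)` and `r(h)` are given as (enumerated) lists over `H0`. -/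
inductive HGen (H0 H1 : Type) (s r : H1 → List H0) : Type
  | vertex (v : H0) : HGen H0 H1 s r
  | edge (h : H1) (i : Fin (s h).length) (j : Fin (r h).length) : HGen H0 H1 s r
  | ghost (h : H1) (i : Fin (s h).length) (j : Fin (r h).length) : HGen H0 H1 s r

namespace HLPA

variable (K : Type) [Field K] (H0 H1 : Type) (s r : H1 → List H0)

/-- The defining relations (i)-(iv) of the Leavitt path algebra of a hypergraph,
imposed on the free algebra on the generators. -/
inductive Rel : FreeAlgebra K (HGen H0 H1 s r) → FreeAlgebra K (HGen H0 H1 s r) → Prop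
  | vtx (u v : H0) :
      Rel (FreeAlgebra.ι K (HGen.vertex u : HGen H0 H1 s r) * FreeAlgebra.ι K (HGen.vertex v))
        (if u = v then FreeAlgebra.ι K (HGen.vertex u : HGen H0 H1 s r) else 0)
  | src_edge (h : H1) (i : Fin (s h).length) (j : Fin (r h).length) :
      Rel (FreeAlgebra.ι K (HGen.vertex ((s h).get i) : HGen H0 H1 s r) *
            FreeAlgebra.ι K (HGen.edge h i j))
        (FreeAlgebra.ι K (HGen.edge h i j))
  | edge_rng (h : H1) (i : Fin (s h).length) (j : Fin (r h).length) :
      Rel (FreeAlgebra.ι K (HGen.edge h i j : HGen H0 H1 s r) *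
            FreeAlgebra.ι K (HGen.vertex ((r h).get j)))
        (FreeAlgebra.ι K (HGen.edge h i j))
  | rng_ghost (h : H1) (i : Fin (s h).length) (j : Fin (r h).length) :
      Rel (FreeAlgebra.ι K (HGen.vertex ((r h).get j) : HGen H0 H1 s r) *
            FreeAlgebra.ι K (HGen.ghost h i j))
        (FreeAlgebra.ι K (HGen.ghost h i j))
  | ghost_src (h : H1) (i : Fin (s h).length) (j : Fin (r h).length) :
      Rel (FreeAlgebra.ι K (HGen.ghost h i j : HGen H0 H1 s r) *
            FreeAlgebra.ι K (HGen.vertex ((s h).get i)))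
        (FreeAlgebra.ι K (HGen.ghost h i j))
  | cuntz1 (h : H1) (i i' : Fin (s h).length) :
      Rel (∑ k : Fin (r h).length,
            FreeAlgebra.ι K (HGen.edge h i k : HGen H0 H1 s r) *
              FreeAlgebra.ι K (HGen.ghost h i' k))
        (if i = i' then FreeAlgebra.ι K (HGen.vertex ((s h).get i) : HGen H0 H1 s r) else 0)
  | cuntz2 (h : H1) (j j' : Fin (r h).length) :
      Rel (∑ k : Fin (s h).length,
            FreeAlgebra.ι K (HGen.ghost h k j : HGen H0 H1 s r) *
              FreeAlgebra.ι K (HGen.edge h k j'))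
        (if j = j' then FreeAlgebra.ι K (HGen.vertex ((r h).get j) : HGen H0 H1 s r) else 0)

/-- The universal unital algebra on the generators subject to the relations (i)-(iv);
it is the unitalization of the Leavitt path algebra of the hypergraph. -/
abbrev Ambient : Type := RingQuot (Rel K H0 H1 s r)

/-- The image of a generator in the ambient algebra. -/
noncomputable def amb (g : HGen H0 H1 s r) : Ambient K H0 H1 s r :=
  RingQuot.mkAlgHom K (Rel K H0 H1 s r) (FreeAlgebra.ι K g)

/-- The Leavitt path algebra of the hypergraph `(H0, H1, s, r)`, realized as the
non-unital subalgebra generated by the generators inside the universal unital algebra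
on the generators subject to the relations (i)-(iv). (This is the algebra presented,
in the category of not necessarily unital `K`-algebras, by said generators and
relations.) -/
noncomputable def LPAsub : NonUnitalSubalgebra K (Ambient K H0 H1 s r) :=
  NonUnitalAlgebra.adjoin K (Set.range (amb K H0 H1 s r))

/-- The Leavitt path algebra `L_K(H)` of the hypergraph `H = (H0, H1, s, r)`. -/
abbrev LPA : Type := ↥(LPAsub K H0 H1 s r)

variable {H0 H1 s r}

/-- A generator, as an element of the Leavitt path algebra. -/
noncomputable def genL (g : HGen H0 H1 s r) : LPA K H0 H1 s r :=
  ⟨amb K H0 H1 s r g, NonUnitalAlgebra.subset_adjoin K (Set.mem_range_self g)⟩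

/-- The vertex generator `v ∈ H0` as an element of the Leavitt path algebra. -/
noncomputable def vgen (v : H0) : LPA K H0 H1 s r := genL K (HGen.vertex v)

/-- The generator `h_{ij}` as an element of the Leavitt path algebra. -/
noncomputable def egen (h : H1) (i : Fin (s h).length) (j : Fin (r h).length) :
    LPA K H0 H1 s r := genL K (HGen.edge h i j)

/-- The generator `h_{ij}^*` as an element of the Leavitt path algebra. -/
noncomputable def ggen (h : H1) (i : Fin (s h).length) (j : Fin (r h).length) :
    LPA K H0 H1 s r := genL K (HGen.ghost h i j)

end HLPA

namespace HLPA

variable (K : Type) [Field K] (H0 H1 : Type) (s r : H1 → List H0)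

noncomputable instance instLPANonUnitalRing : NonUnitalRing (LPA K H0 H1 s r) :=
  NonUnitalSubalgebra.toNonUnitalRing (LPAsub K H0 H1 s r)

noncomputable instance instLPAAddCommGroup : AddCommGroup (LPA K H0 H1 s r) :=
  (instLPANonUnitalRing K H0 H1 s r).toAddCommGroup

noncomputable instance instLPAModule : Module K (LPA K H0 H1 s r) :=
  (LPAsub K H0 H1 s r).instModule

end HLPA

/-- `I` is a left ideal of the (not necessarily unital) ring `R`, encoded as a set. -/
def IsLeftIdealSet (R : Type) [NonUnitalRing R] (I : Set R) : Prop :=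
  0 ∈ I ∧ (∀ x ∈ I, ∀ y ∈ I, x + y ∈ I) ∧ (∀ x ∈ I, -x ∈ I) ∧
    (∀ (a : R), ∀ x ∈ I, a * x ∈ I)

/-- `I` is a right ideal of the (not necessarily unital) ring `R`, encoded as a set. -/
def IsRightIdealSet (R : Type) [NonUnitalRing R] (I : Set R) : Prop :=
  0 ∈ I ∧ (∀ x ∈ I, ∀ y ∈ I, x + y ∈ I) ∧ (∀ x ∈ I, -x ∈ I) ∧
    (∀ (a : R), ∀ x ∈ I, x * a ∈ I)

/-- `I` is a two-sided ideal of the (not necessarily unital) ring `R`, encoded as a set. -/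
def IsTwoSidedIdealSet (R : Type) [NonUnitalRing R] (I : Set R) : Prop :=
  0 ∈ I ∧ (∀ x ∈ I, ∀ y ∈ I, x + y ∈ I) ∧ (∀ x ∈ I, -x ∈ I) ∧
    (∀ (a : R), ∀ x ∈ I, a * x ∈ I) ∧ (∀ (a : R), ∀ x ∈ I, x * a ∈ I)

namespace HLPA

section MatrixUnits

variable {R V ι : Type*} [CommRing R] [AddCommGroup V] [Module R V]

/-- The endomorphism of `ι → V` with the single nonzero matrix entry `a` at position `(v, w)`. -/
noncomputable def matUnit (v w : ι) (a : Module.End R V) : Module.End R (ι → V) :=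
  LinearMap.single R (fun _ => V) v ∘ₗ a ∘ₗ LinearMap.proj w

theorem matUnit_apply (v w : ι) (a : Module.End R V) (x : ι → V) :
    matUnit v w a x = Pi.single v (a (x w)) := rfl

theorem matUnit_mul_same (u v w : ι) (a b : Module.End R V) :
    matUnit u v a * matUnit v w b = matUnit u w (a * b) := by
  ext1 x
  simp [matUnit_apply]

theorem matUnit_mul_of_ne {v v' : ι} (hv : v ≠ v') (u w : ι) (a b : Module.End R V) :
    matUnit u v a * matUnit v' w b = 0 := by
  ext1 x
  simp [matUnit_apply, Pi.single_eq_of_ne hv]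

theorem matUnit_zero (v w : ι) : matUnit v w (0 : Module.End R V) = 0 := by
  ext1 x
  simp [matUnit_apply]

theorem matUnit_sum {κ : Type*} (t : Finset κ) (v w : ι) (a : κ → Module.End R V) :
    matUnit v w (∑ k ∈ t, a k) = ∑ k ∈ t, matUnit v w (a k) := by
  ext1 x
  simp only [matUnit_apply, LinearMap.sum_apply]
  exact map_sum (LinearMap.single R (fun _ => V) v) _ _

/-- The `(i, j)` entry of a linear map between powers of `V`. -/
noncomputable def entry {m n : ℕ} (f : (Fin n → V) →ₗ[R] (Fin m → V)) (i : Fin m) (j : Fin n) :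
    Module.End R V :=
  LinearMap.proj i ∘ₗ f ∘ₗ LinearMap.single R (fun _ => V) j

theorem entry_apply {m n : ℕ} (f : (Fin n → V) →ₗ[R] (Fin m → V)) (i : Fin m) (j : Fin n)
    (x : V) : entry f i j x = f (Pi.single j x) i := rfl

theorem sum_entry_mul_entry {l m n : ℕ} (f : (Fin m → V) →ₗ[R] (Fin l → V))
    (g : (Fin n → V) →ₗ[R] (Fin m → V)) (i : Fin l) (j : Fin n) :
    ∑ k, entry f i k * entry g k j = entry (f ∘ₗ g) i j := by
  ext1 x
  simp only [LinearMap.sum_apply, Module.End.mul_apply, entry_apply, LinearMap.comp_apply]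
  rw [← Finset.sum_apply, ← map_sum, Finset.univ_sum_single]

theorem entry_id {n : ℕ} (i j : Fin n) :
    entry (LinearMap.id : (Fin n → V) →ₗ[R] (Fin n → V)) i j = if i = j then 1 else 0 := by
  ext1 x
  by_cases h : i = j
  · subst h
    simp [entry_apply]
  · simp [entry_apply, h]

end MatrixUnits

section Representation

variable (K : Type) [Field K] {H0 H1 : Type} {s r : H1 → List H0}
  {R V : Type} [CommRing R] [Algebra K R] [AddCommGroup V] [Module R V] [Module K V]
  [IsScalarTower K R V]
  (e : ∀ h, (Fin (r h).length → V) ≃ₗ[R] (Fin (s h).length → V))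

/-- The action of the generators on `H0 → V` determined by isomorphisms
`V ^ |r(h)| ≃ V ^ |s(h)|`. -/
noncomputable def genAction : HGen H0 H1 s r → Module.End R (H0 → V)
  | .vertex v => matUnit v v 1
  | .edge h i j => matUnit ((s h).get i) ((r h).get j) (entry (e h).toLinearMap i j)
  | .ghost h i j => matUnit ((r h).get j) ((s h).get i) (entry (e h).symm.toLinearMap j i)

theorem genAction_rel ⦃x y : FreeAlgebra K (HGen H0 H1 s r)⦄ (hxy : Rel K H0 H1 s r x y) :
    FreeAlgebra.lift K (genAction e) x = FreeAlgebra.lift K (genAction e) y := by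
  cases hxy with
  | vtx u v =>
    by_cases h : u = v
    · subst h
      simp [genAction, matUnit_mul_same]
    · simp [genAction, h, matUnit_mul_of_ne]
  | cuntz1 h i i' =>
    simp only [map_sum, map_mul, FreeAlgebra.lift_ι_apply, genAction, matUnit_mul_same]
    rw [← matUnit_sum, sum_entry_mul_entry, LinearEquiv.comp_coe, LinearEquiv.symm_trans_self,
      LinearEquiv.refl_toLinearMap, entry_id]
    by_cases hi : i = i'
    · subst hi
      simp [genAction]
    · simp [hi, matUnit_zero]
  | cuntz2 h j j' =>
    simp only [map_sum, map_mul, FreeAlgebra.lift_ι_apply, genAction, matUnit_mul_same]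
    rw [← matUnit_sum, sum_entry_mul_entry, LinearEquiv.comp_coe, LinearEquiv.self_trans_symm,
      LinearEquiv.refl_toLinearMap, entry_id]
    by_cases hj : j = j'
    · subst hj
      simp [genAction]
    · simp [hj, matUnit_zero]
  | _ =>
    simp only [map_mul, FreeAlgebra.lift_ι_apply, genAction, matUnit_mul_same, one_mul, mul_one]

/-- The representation of the ambient algebra on `H0 → V` determined by isomorphisms
`V ^ |r(h)| ≃ V ^ |s(h)|`. -/
noncomputable def repr : Ambient K H0 H1 s r →ₐ[K] Module.End R (H0 → V) :=
  RingQuot.liftAlgHom K ⟨FreeAlgebra.lift K (genAction e), genAction_rel K e⟩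

theorem repr_amb (g : HGen H0 H1 s r) : repr K e (amb K H0 H1 s r g) = genAction e g := by
  simp [repr, amb]

end Representation

section Powers

variable {R : Type} [CommRing R]

theorem nonempty_pow_equiv {m : ℕ} (hm : 1 ≤ m) :
    Nonempty ((Fin m → ℕ → R) ≃ₗ[R] (ℕ → R)) := by
  have : Nonempty (Fin m) := ⟨⟨0, hm⟩⟩
  obtain ⟨f⟩ : Nonempty (ℕ ≃ Fin m × ℕ) := nonempty_equiv_of_countable
  exact ⟨(LinearEquiv.curry R R (Fin m) ℕ).symm ≪≫ₗ LinearEquiv.funCongrLeft R R f⟩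

theorem exists_pow_equiv_prod {m : ℕ} (hm : 2 ≤ m) :
    ∃ e : (Fin m → ℕ → R) ≃ₗ[R] (ℕ → R) × (ℕ → R),
      ∀ x : Fin m → ℕ → R, (e x).1 = x ⟨0, by omega⟩ ∧
        ∀ v : ℕ → R, e (Pi.single ⟨0, by omega⟩ v) = (v, 0) := by
  obtain ⟨k, rfl⟩ : ∃ k, m = k + 1 := ⟨m - 1, by omega⟩
  obtain ⟨f⟩ := nonempty_pow_equiv (R := R) (show 1 ≤ k by omega)
  let c := (Fin.consLinearEquiv R (fun _ : Fin (k + 1) => ℕ → R)).symm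
  refine ⟨c ≪≫ₗ (LinearEquiv.refl R (ℕ → R)).prodCongr f, fun x => ⟨rfl, fun v => ?_⟩⟩
  refine Prod.ext rfl ?_
  change f (fun i : Fin k => (Pi.single (0 : Fin (k + 1)) v : Fin (k + 1) → ℕ → R) i.succ) = 0
  rw [← map_zero f]
  congr 1

/-- The automorphism of `V × V` given by the matrix `((t, t - 1), (1, 1))`. -/
def twist (V : Type) [AddCommGroup V] [Module R V] (t : R) : (V × V) ≃ₗ[R] V × V where
  toFun x := (t • x.1 + (t - 1) • x.2, x.1 + x.2)
  invFun x := (x.1 - (t - 1) • x.2, t • x.2 - x.1)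
  map_add' x y := by ext1 <;> simp only [Prod.fst_add, Prod.snd_add] <;> module
  map_smul' a x := by
    ext1 <;> simp only [Prod.smul_fst, Prod.smul_snd, RingHom.id_apply] <;> module
  left_inv x := by ext1 <;> dsimp only <;> module
  right_inv x := by ext1 <;> dsimp only <;> module

theorem exists_pow_equiv_pow (t : R) {m n : ℕ} (hm : 1 ≤ m) (hn : 1 ≤ n) :
    ∃ e : (Fin n → ℕ → R) ≃ₗ[R] (Fin m → ℕ → R), ∀ (hm' : 2 ≤ m) (hn' : 2 ≤ n),
      entry e.toLinearMap ⟨0, by omega⟩ ⟨0, by omega⟩ *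
        entry e.symm.toLinearMap ⟨0, by omega⟩ ⟨0, by omega⟩ = t • 1 := by
  by_cases h : 2 ≤ m ∧ 2 ≤ n
  · obtain ⟨f, hf⟩ := exists_pow_equiv_prod (R := R) h.1
    obtain ⟨g, hg⟩ := exists_pow_equiv_prod (R := R) h.2
    refine ⟨g ≪≫ₗ twist (ℕ → R) t ≪≫ₗ f.symm, fun _ _ => ?_⟩
    ext1 x
    simp only [Module.End.mul_apply, entry_apply, LinearEquiv.coe_coe, LinearEquiv.trans_apply,
      LinearEquiv.trans_symm, LinearEquiv.symm_symm, (hg 0).2, (hf 0).2]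
    rw [← (hf (f.symm _)).1, ← (hg (g.symm _)).1]
    simp [twist]
  · obtain ⟨f⟩ := nonempty_pow_equiv (R := R) hm
    obtain ⟨g⟩ := nonempty_pow_equiv (R := R) hn
    exact ⟨g ≪≫ₗ f.symm, fun h1 h2 => (h ⟨h1, h2⟩).elim⟩

end Powers

/-- Under Condition (A), some vertex `u` and some `p` in the Leavitt path algebra act on a power
of `R` as the idempotent at `u` and as `t` times that idempotent, respectively. -/
theorem exists_repr (K : Type) [Field K] {H0 H1 : Type} {s r : H1 → List H0}
    (hs : ∀ h, s h ≠ []) (hr : ∀ h, r h ≠ [])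
    (hA : ∃ h : H1, 2 ≤ (s h).length ∧ 2 ≤ (r h).length)
    {R : Type} [CommRing R] [Algebra K R] (t : R) :
    ∃ (ρ : Ambient K H0 H1 s r →ₐ[K] Module.End R (H0 → ℕ → R)) (u : H0)
      (p : LPA K H0 H1 s r),
      ρ (vgen K u : LPA K H0 H1 s r) = matUnit u u 1 ∧ ρ p = matUnit u u (t • 1) := by
  choose e he using fun h => exists_pow_equiv_pow t
    (List.length_pos_iff.2 (hs h)) (List.length_pos_iff.2 (hr h))
  obtain ⟨h, h1, h2⟩ := hA
  refine ⟨repr K e, (s h).get ⟨0, by omega⟩,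
    egen K h ⟨0, by omega⟩ ⟨0, by omega⟩ * ggen K h ⟨0, by omega⟩ ⟨0, by omega⟩,
    repr_amb K e _, ?_⟩
  refine (map_mul (repr K e) _ _).trans ?_
  refine (congrArg₂ (· * ·) (repr_amb K e _) (repr_amb K e _)).trans ?_
  simp only [genAction, matUnit_mul_same, he h h1 h2]

section Filtration

variable {K R W : Type} [Field K] [CommRing R] [Algebra K R] [AddCommGroup W] [Module R W]
  [Module K W] [IsScalarTower K R W]

variable (K W) in
/-- The endomorphisms of `W` whose values are all multiples of `t`. -/
def divisibleEnd (t : R) : Submodule K (Module.End R W) where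
  carrier := {f | ∀ w, ∃ w', f w = t • w'}
  zero_mem' w := ⟨0, by simp⟩
  add_mem' {f g} hf hg w := by
    obtain ⟨a, ha⟩ := hf w
    obtain ⟨b, hb⟩ := hg w
    exact ⟨a + b, by simp [ha, hb]⟩
  smul_mem' c f hf w := by
    obtain ⟨a, ha⟩ := hf w
    exact ⟨c • a, by rw [LinearMap.smul_apply, ha, smul_comm]⟩

theorem mul_mem_divisibleEnd_left {t : R} (g : Module.End R W) {f : Module.End R W}
    (hf : f ∈ divisibleEnd K W t) : g * f ∈ divisibleEnd K W t := fun w => by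
  obtain ⟨a, ha⟩ := hf w
  exact ⟨g a, by rw [Module.End.mul_apply, ha, map_smul]⟩

theorem mul_mem_divisibleEnd_right {t : R} (g : Module.End R W) {f : Module.End R W}
    (hf : f ∈ divisibleEnd K W t) : f * g ∈ divisibleEnd K W t := fun w => hf (g w)

theorem divisibleEnd_pow_succ_le (t : R) (n : ℕ) :
    divisibleEnd K W (t ^ (n + 1)) ≤ divisibleEnd K W (t ^ n) := fun f hf w => by
  obtain ⟨a, ha⟩ := hf w
  exact ⟨t • a, by rw [ha, pow_succ, mul_smul]⟩

end Filtration

end HLPA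

open HLPA in
/-- **Theorem 8.11.** Let `H` be a hypergraph that satisfies Condition (A) (there is an
`h ∈ H^1` with `|s(h)|, |r(h)| ≥ 2`). Then `L_K(H)` is infinite-dimensional over `K`,
has infinitely many two-sided ideals (in particular it is not simple), is neither left
nor right Artinian, and is not von Neumann regular. -/
theorem stmt_18 (K : Type) [Field K] (H0 H1 : Type) [Nonempty H0]
    (s r : H1 → List H0) (hs : ∀ h, s h ≠ []) (hr : ∀ h, r h ≠ [])
    (hA : ∃ h : H1, 2 ≤ (s h).length ∧ 2 ≤ (r h).length) :
    ¬ Module.Finite K (LPA K H0 H1 s r) ∧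
    Set.Infinite {I : Set (LPA K H0 H1 s r) | IsTwoSidedIdealSet (LPA K H0 H1 s r) I} ∧
    (∃ C : ℕ → Set (LPA K H0 H1 s r),
      (∀ n, IsLeftIdealSet (LPA K H0 H1 s r) (C n)) ∧ ∀ n, C (n + 1) ⊂ C n) ∧
    (∃ C : ℕ → Set (LPA K H0 H1 s r),
      (∀ n, IsRightIdealSet (LPA K H0 H1 s r) (C n)) ∧ ∀ n, C (n + 1) ⊂ C n) ∧
    (∃ x : LPA K H0 H1 s r, ∀ y, x * y * x ≠ x) := by
  obtain ⟨ρ, u, p, hu, hp⟩ := exists_repr K hs hr hA (Polynomial.X : Polynomial K)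
  let P (n : ℕ) : Submodule K (LPA K H0 H1 s r) :=
    (divisibleEnd K (H0 → ℕ → Polynomial K) ((Polynomial.X : Polynomial K) ^ n)).comap
      (ρ.toLinearMap ∘ₗ (LPAsub K H0 H1 s r).toSubmodule.subtype)
  have hmem (n : ℕ) (x : LPA K H0 H1 s r) : x ∈ P n ↔
      ρ x ∈ divisibleEnd K (H0 → ℕ → Polynomial K) ((Polynomial.X : Polynomial K) ^ n) := Iff.rfl
  have hpow (n : ℕ) : ∃ x : LPA K H0 H1 s r,
      ρ x = matUnit u u ((Polynomial.X : Polynomial K) ^ n • 1) := by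
    induction n with
    | zero => exact ⟨vgen K u, by simpa using hu⟩
    | succ n ih =>
      obtain ⟨x, hx⟩ := ih
      refine ⟨p * x, (map_mul ρ _ _).trans ?_⟩
      rw [hp, hx, matUnit_mul_same, smul_mul_smul_comm, one_mul, pow_succ']
  have hlt (n : ℕ) : P (n + 1) < P n := by
    refine lt_of_le_of_ne (Submodule.comap_mono (divisibleEnd_pow_succ_le _ n)) fun h => ?_
    obtain ⟨x, hx⟩ := hpow n
    have hx' : x ∈ P n := by
      intro w
      refine ⟨Pi.single u (w u), ?_⟩
      change ρ x w = _
      rw [hx, matUnit_apply, ← Pi.single_smul]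
      rfl
    rw [← h] at hx'
    obtain ⟨w, hw⟩ := hx' (Pi.single u 1)
    change ρ x _ = _ at hw
    rw [hx, matUnit_apply] at hw
    have h0 := congrFun (congrFun hw u) 0
    simp only [Pi.single_eq_same, Pi.smul_apply, smul_eq_mul, LinearMap.smul_apply,
      Module.End.one_apply, Pi.one_apply, mul_one] at h0
    have hd : (Polynomial.X : Polynomial K) ^ (n + 1) ∣ Polynomial.X ^ n := ⟨_, h0⟩
    rw [pow_dvd_pow_iff Polynomial.X_ne_zero Polynomial.not_isUnit_X] at hd
    omega
  have hanti : StrictAnti P := strictAnti_nat_of_succ_lt hlt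
  have hideal (n : ℕ) : IsTwoSidedIdealSet (LPA K H0 H1 s r) (P n) := by
    refine ⟨(P n).zero_mem, fun x hx y hy => (P n).add_mem hx hy, fun x hx => (P n).neg_mem hx,
      fun a x hx => ?_, fun a x hx => ?_⟩
    · refine (hmem n _).2 (?_ : ρ ((a : Ambient K H0 H1 s r) * x) ∈ _)
      exact map_mul ρ _ _ ▸ mul_mem_divisibleEnd_left _ ((hmem n x).1 hx)
    · refine (hmem n _).2 (?_ : ρ ((x : Ambient K H0 H1 s r) * a) ∈ _)
      exact map_mul ρ _ _ ▸ mul_mem_divisibleEnd_right _ ((hmem n x).1 hx)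
  refine ⟨fun hfin => ?_, ?_, ⟨fun n => P n, fun n => ?_, hlt⟩, ⟨fun n => P n, fun n => ?_, hlt⟩,
    p, fun y hy => ?_⟩
  · obtain ⟨n, hn⟩ := IsArtinian.monotone_stabilizes (⟨P, hanti.antitone⟩ : ℕ →o (Submodule K _)ᵒᵈ)
    exact (hlt n).ne' (hn (n + 1) n.le_succ)
  · exact Set.infinite_of_injective_forall_mem (f := fun n => (P n : Set (LPA K H0 H1 s r)))
      (SetLike.coe_injective.comp hanti.injective) hideal
  · exact ⟨(hideal n).1, (hideal n).2.1, (hideal n).2.2.1, (hideal n).2.2.2.1⟩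
  · exact ⟨(hideal n).1, (hideal n).2.1, (hideal n).2.2.1, (hideal n).2.2.2.2⟩
  · have hy' : ρ p * ρ y * ρ p = ρ p := by
      rw [← map_mul, ← map_mul]
      exact congrArg (fun z : LPA K H0 H1 s r => ρ z) hy
    have h0 := congrFun (congrFun (LinearMap.congr_fun hy' (Pi.single u 1)) u) 0
    rw [hp] at h0
    simp only [Module.End.mul_apply, matUnit_apply, Pi.single_eq_same, LinearMap.smul_apply,
      Module.End.one_apply, Pi.smul_apply, smul_eq_mul, Pi.one_apply, mul_one,
      Pi.single_smul, map_smul] at h0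
    have hX := mul_left_cancel₀ Polynomial.X_ne_zero (h0.trans (mul_one _).symm)
    exact Polynomial.not_isUnit_X (IsUnit.of_mul_eq_one _ hX)
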